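/- (Generating function for the ω_{r,n}.) Let p be a prime, r ≥ 1, d = p^{2r}, and let ζ be a primitive d-th root of unity in a field C of characteristic 0. Define ω_{r,n} = ζ^{n(n+1)/2} Σ_{k=0}^{p^r−1} [k p^r choose n]_ζ for 0 ≤ n ≤ d−1. Then, as an identity of polynomials in C[X], Σ_{n=0}^{d−1} (−1)^n ω_{r,n} X^n = Σ_{k=0}^{p^r − 1} ∏_{l=1}^{k p^r} (1 − ζ^l X). -/

import Mathlib

/-- The `q`-Pochhammer symbol `(q;q)_n = ∏_{k=1}^n (1 - q^k)` in `ℤ[q]`. -/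
noncomputable def qPoch (n : ℕ) : Polynomial ℤ :=
  ∏ i ∈ Finset.range n, (1 - Polynomial.X ^ (i + 1))

theorem qPoch_zero : qPoch 0 = 1 := by simp [qPoch]

open Polynomial in
theorem qPoch_succ (n : ℕ) : qPoch (n + 1) = qPoch n * (1 - X ^ (n + 1)) := by
  simp [qPoch, Finset.prod_range_succ]

open Polynomial in
theorem qPoch_ne_zero (n : ℕ) : qPoch n ≠ 0 := by
  refine Finset.prod_ne_zero_iff.2 fun i _ h => ?_
  simpa using congrArg (eval 0) h

/-- The Gaussian binomial `[n choose 0]_q` is `1`. -/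
theorem gaussBinom_zero_right {B : ℕ → ℕ → Polynomial ℤ}
    (hB1 : ∀ n k : ℕ, k ≤ n → B n k * (qPoch k * qPoch (n - k)) = qPoch n) (n : ℕ) :
    B n 0 = 1 := by
  have h := hB1 n 0 n.zero_le
  rw [qPoch_zero, one_mul, Nat.sub_zero] at h
  exact mul_right_cancel₀ (qPoch_ne_zero n) (h.trans (one_mul _).symm)

open Polynomial in
/-- The `q`-Pascal rule. -/
theorem gaussBinom_succ_succ {B : ℕ → ℕ → Polynomial ℤ}
    (hB0 : ∀ n k : ℕ, n < k → B n k = 0)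
    (hB1 : ∀ n k : ℕ, k ≤ n → B n k * (qPoch k * qPoch (n - k)) = qPoch n)
    {m n : ℕ} (h : n ≤ m) :
    B (m + 1) (n + 1) = B m (n + 1) + X ^ (m - n) * B m n := by
  obtain ⟨d, rfl⟩ := Nat.exists_eq_add_of_le h
  apply mul_right_cancel₀ (mul_ne_zero (qPoch_ne_zero (n + 1)) (qPoch_ne_zero d))
  have h1 := hB1 (n + d + 1) (n + 1) (by omega)
  have h2 := hB1 (n + d) n h
  rw [show n + d + 1 - (n + 1) = d by omega, qPoch_succ (n + d)] at h1
  rw [Nat.add_sub_cancel_left] at h2 ⊢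
  have h3 : B (n + d) (n + 1) * (qPoch (n + 1) * qPoch d) = qPoch (n + d) * (1 - X ^ d) := by
    cases d with
    | zero => simp [hB0 n (n + 1) (Nat.lt_succ_self n)]
    | succ e =>
      have h4 := hB1 (n + (e + 1)) (n + 1) (by omega)
      rw [show n + (e + 1) - (n + 1) = e by omega] at h4
      rw [qPoch_succ e, ← h4]
      ring
  rw [h1, add_mul, h3, qPoch_succ n, ← h2]
  ring

open Polynomial in
/-- The `q`-binomial theorem, coefficientwise. -/
theorem coeff_prod_one_sub_pow_mul_X {R : Type*} [CommRing R] (q : R)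
    {B : ℕ → ℕ → Polynomial ℤ}
    (hB0 : ∀ n k : ℕ, n < k → B n k = 0)
    (hB1 : ∀ n k : ℕ, k ≤ n → B n k * (qPoch k * qPoch (n - k)) = qPoch n) (m n : ℕ) :
    (∏ l ∈ Finset.range m, (1 - C (q ^ (l + 1)) * (X : R[X]))).coeff n =
      (-1) ^ n * (q ^ (n * (n + 1) / 2) * aeval q (B m n)) := by
  induction m generalizing n with
  | zero =>
    cases n with
    | zero => simp [gaussBinom_zero_right hB1]
    | succ n => simp [hB0 0 (n + 1) n.succ_pos, coeff_one]
  | succ m ih =>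
    rw [Finset.prod_range_succ, mul_sub, mul_one, mul_left_comm, coeff_sub, coeff_C_mul]
    cases n with
    | zero =>
      rw [mul_coeff_zero, coeff_X_zero, mul_zero, mul_zero, sub_zero, ih]
      simp [gaussBinom_zero_right hB1]
    | succ n =>
      rw [coeff_mul_X, ih, ih]
      have ht : (n + 1) * (n + 1 + 1) / 2 = n * (n + 1) / 2 + (n + 1) := by
        rw [show (n + 1) * (n + 1 + 1) = n * (n + 1) + (n + 1) * 2 by ring,
          Nat.add_mul_div_right _ _ two_pos]
      rcases le_or_gt n m with h | h
      · rw [gaussBinom_succ_succ hB0 hB1 h, ht, map_add, map_mul, map_pow, aeval_X]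
        obtain ⟨d, rfl⟩ := Nat.exists_eq_add_of_le h
        rw [Nat.add_sub_cancel_left]
        ring
      · simp [hB0 m n h, hB0 m (n + 1) (by omega), hB0 (m + 1) (n + 1) (by omega)]

open Polynomial in
/-- **Generating function for the `ω_{r,n}`** (Ophir–de Shalit, end of §4.5).  For `ζ` a
primitive `p^{2r}`-th root of unity in a characteristic-zero field `C`, with
`ω_{r,n} = ζ^{n(n+1)/2} Σ_{k=0}^{p^r−1} [k p^r choose n]_ζ`, one has the identity in `C[X]`:
`Σ_{n=0}^{d−1} (−1)^n ω_{r,n} X^n = Σ_{k=0}^{p^r−1} ∏_{l=1}^{k p^r} (1 − ζ^l X)`.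
Here `B` is the Gaussian binomial coefficient `[n choose k]_q ∈ ℤ[q]`, characterized by
`[n choose k]_q (q;q)_k (q;q)_{n−k} = (q;q)_n` for `k ≤ n` and `[n choose k]_q = 0` for
`k > n`; `[m choose n]_ζ` is its evaluation at `q = ζ`. -/
theorem stmt_11 (p : ℕ) (hp : p.Prime) (r : ℕ) (hr : 1 ≤ r)
    (C : Type*) [Field C] [CharZero C] (ζ : C) (hζ : IsPrimitiveRoot ζ (p ^ (2 * r)))
    (B : ℕ → ℕ → Polynomial ℤ)
    (hB0 : ∀ n k : ℕ, n < k → B n k = 0)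
    (hB1 : ∀ n k : ℕ, k ≤ n → B n k * (qPoch k * qPoch (n - k)) = qPoch n) :
    ∑ n ∈ Finset.range (p ^ (2 * r)),
        Polynomial.C ((-1) ^ n *
            (ζ ^ (n * (n + 1) / 2) *
              ∑ k ∈ Finset.range (p ^ r), Polynomial.aeval ζ (B (k * p ^ r) n))) *
          (X : C[X]) ^ n
      = ∑ k ∈ Finset.range (p ^ r),
          ∏ l ∈ Finset.range (k * p ^ r), (1 - Polynomial.C (ζ ^ (l + 1)) * (X : C[X])) := by
  ext n
  simp only [finsetSum_coeff, coeff_C_mul_X_pow, coeff_prod_one_sub_pow_mul_X ζ hB0 hB1,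
    Finset.sum_ite_eq, Finset.mem_range]
  split_ifs with h
  · simp only [Finset.mul_sum]
  · refine (Finset.sum_eq_zero fun k hk => ?_).symm
    have hlt : k * p ^ r < p ^ (2 * r) := by
      rw [two_mul, pow_add]
      exact Nat.mul_lt_mul_of_pos_right (Finset.mem_range.1 hk) (pow_pos hp.pos r)
    rw [hB0 _ _ (hlt.trans_le (not_lt.1 h)), map_zero, mul_zero, mul_zero]
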